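/- arXiv:2101.02364 — 6 statements merged into one kernel-verified Lean document; each statement's English description precedes it below -/
import Mathlib

section
/- Let $a_n, b_n$ be complex numbers with $a_n \neq 0$ for all $n \in \mathbb{N}$. Suppose that $\sup_{n \in \mathbb{N}} \left\{ n \prod_{j=1}^{n-1} |a_j| \right\} = \infty$ and $\sup_{n \in \mathbb{N}} \prod_{j=1}^{n-1} |a_j| < \infty$. Then the difference equation $z_{n+1} = a_n z_n + b_n$ does not have Hyers-Ulam stability: for every $\varepsilon > 0$ there exists a sequence $\{w_n\}$ with $|w_{n+1} - a_n w_n - b_n| \leq \varepsilon$ for all $n$, such that for every sequence $\{z_n\}$ satisfying $z_{n+1} = a_n z_n + b_n$ for all $n$, the quantity $\sup_{n \in \mathbb{N}} |w_n - z_n|$ is infinite. -/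
/-- If `sup_n n ∏_{j=1}^{n-1} |a_j| = ∞` while `sup_n ∏_{j=1}^{n-1} |a_j| < ∞`,
then the difference equation `z_{n+1} = a_n z_n + b_n` has no Hyers-Ulam stability. -/
theorem stmt_6 (a b : ℕ → ℂ) (ha : ∀ n, 1 ≤ n → a n ≠ 0)
    (hsup : ∀ C : ℝ, ∃ n : ℕ, 1 ≤ n ∧
      C < (n : ℝ) * (∏ j ∈ Finset.Ico 1 n, ‖a j‖))
    (hbdd : ∃ M : ℝ, ∀ n, 1 ≤ n → (∏ j ∈ Finset.Ico 1 n, ‖a j‖) ≤ M) :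
    ∀ ε : ℝ, 0 < ε → ∃ w : ℕ → ℂ,
      (∀ n, 1 ≤ n → ‖w (n + 1) - (a n * w n + b n)‖ ≤ ε) ∧
      ∀ z : ℕ → ℂ, (∀ n, 1 ≤ n → z (n + 1) = a n * z n + b n) →
        ∀ C : ℝ, ∃ n, 1 ≤ n ∧ C < ‖w n - z n‖ := by
  intro ε hε
  obtain ⟨M, hM⟩ := hbdd
  have hM1 : (1 : ℝ) ≤ M := by simpa using hM 1 le_rfl
  have hM0 : (0 : ℝ) < M := by linarith
  set P : ℕ → ℂ := fun n => ∏ j ∈ Finset.Ico 1 n, a j with hP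
  have hPn : ∀ n, ‖P n‖ = ∏ j ∈ Finset.Ico 1 n, ‖a j‖ := fun n => by
    simp only [hP, norm_prod]
  have hPs : ∀ n, 1 ≤ n → P (n + 1) = a n * P n := fun n hn => by
    simp only [hP]
    rw [Finset.prod_Ico_succ_top hn, mul_comm]
  have hP1 : P 1 = 1 := by simp [hP]
  set u : ℕ → ℂ := fun n => Nat.rec 0 (fun k x => a k * x + b k) n with hu
  have hus : ∀ n, u (n + 1) = a n * u n + b n := fun n => rfl
  have hc : 0 < ε / M := by positivity
  refine ⟨fun n => u n + P n * (((ε / M : ℝ) : ℂ) * (n : ℂ)), ?_, ?_⟩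
  · intro n hn
    have h : u (n + 1) + P (n + 1) * (((ε / M : ℝ) : ℂ) * ((n + 1 : ℕ) : ℂ))
        - (a n * (u n + P n * (((ε / M : ℝ) : ℂ) * (n : ℂ))) + b n)
        = ((ε / M : ℝ) : ℂ) * P (n + 1) := by
      rw [hus, hPs n hn]; push_cast; ring
    show ‖u (n + 1) + P (n + 1) * (((ε / M : ℝ) : ℂ) * ((n + 1 : ℕ) : ℂ))
        - (a n * (u n + P n * (((ε / M : ℝ) : ℂ) * (n : ℂ))) + b n)‖ ≤ ε
    rw [h, norm_mul, Complex.norm_real, Real.norm_of_nonneg hc.le, hPn]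
    calc ε / M * _ ≤ ε / M * M := by
          gcongr
          exact hM (n + 1) (by omega)
      _ = ε := by field_simp
  · intro z hz C
    have hd : ∀ n, 1 ≤ n → u n - z n = P n * (u 1 - z 1) := by
      intro n hn
      induction n, hn using Nat.le_induction with
      | base => rw [hP1, one_mul]
      | succ k hk ih =>
        rw [hus, hz k hk, hPs k hk, mul_assoc, ← ih]; ring
    obtain ⟨n, hn, hlt⟩ := hsup ((C + M * ‖u 1 - z 1‖) / (ε / M))
    refine ⟨n, hn, ?_⟩
    have e : u n + P n * (((ε / M : ℝ) : ℂ) * (n : ℂ)) - z n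
        = P n * (((ε / M : ℝ) : ℂ) * (n : ℂ)) + P n * (u 1 - z 1) := by
      rw [← hd n hn]; ring
    show C < ‖u n + P n * (((ε / M : ℝ) : ℂ) * (n : ℂ)) - z n‖
    rw [e]
    have h1 := norm_sub_le_norm_add (P n * (((ε / M : ℝ) : ℂ) * (n : ℂ))) (P n * (u 1 - z 1))
    have h2 : ‖P n * (u 1 - z 1)‖ ≤ M * ‖u 1 - z 1‖ := by
      rw [norm_mul]
      gcongr
      rw [hPn]; exact hM n hn
    have h3 : ‖P n * (((ε / M : ℝ) : ℂ) * (n : ℂ))‖ = (n * ‖P n‖) * (ε / M) := by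
      rw [norm_mul, norm_mul, Complex.norm_real, Real.norm_of_nonneg hc.le, Complex.norm_natCast]
      ring
    rw [div_lt_iff₀ hc, ← hPn] at hlt
    linarith
end

section
/- Let $a_n, b_n$ be complex numbers with $a_n \neq 0$ for all $n \in \mathbb{N}$. Suppose that $0 < \inf_{n \in \mathbb{N}} \prod_{j=1}^{n-1} |a_j| \leq \sup_{n \in \mathbb{N}} \prod_{j=1}^{n-1} |a_j| < \infty$. Then the difference equation $z_{n+1} = a_n z_n + b_n$ does not have Hyers-Ulam stability: for every $\varepsilon > 0$ there exists a sequence $\{w_n\}$ with $|w_{n+1} - a_n w_n - b_n| \leq \varepsilon$ for all $n$, such that for every sequence $\{z_n\}$ satisfying $z_{n+1} = a_n z_n + b_n$ for all $n$, the quantity $\sup_{n \in \mathbb{N}} |w_n - z_n|$ is infinite. -/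
/-- If `0 < inf_n ∏_{j=1}^{n-1} |a_j| ≤ sup_n ∏_{j=1}^{n-1} |a_j| < ∞`,
then the difference equation `z_{n+1} = a_n z_n + b_n` has no Hyers-Ulam stability. -/
theorem stmt_7 (a b : ℕ → ℂ) (ha : ∀ n, 1 ≤ n → a n ≠ 0)
    (hinf : ∃ c : ℝ, 0 < c ∧
      ∀ n, 1 ≤ n → c ≤ ∏ j ∈ Finset.Ico 1 n, ‖a j‖)
    (hbdd : ∃ M : ℝ, ∀ n, 1 ≤ n → (∏ j ∈ Finset.Ico 1 n, ‖a j‖) ≤ M) :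
    ∀ ε : ℝ, 0 < ε → ∃ w : ℕ → ℂ,
      (∀ n, 1 ≤ n → ‖w (n + 1) - (a n * w n + b n)‖ ≤ ε) ∧
      ∀ z : ℕ → ℂ, (∀ n, 1 ≤ n → z (n + 1) = a n * z n + b n) →
        ∀ C : ℝ, ∃ n, 1 ≤ n ∧ C < ‖w n - z n‖ := by
  obtain ⟨c, hc, hcP⟩ := hinf
  obtain ⟨M, hM⟩ := hbdd
  intro ε hε
  have hMpos : 0 < M := lt_of_lt_of_le hc ((hcP 1 le_rfl).trans (hM 1 le_rfl))
  obtain ⟨y, hy⟩ : ∃ y : ℕ → ℂ, ∀ n, y (n + 1) = a n * y n + b n :=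
    ⟨fun n => Nat.rec 0 (fun k v => a k * v + b k) n, fun n => rfl⟩
  obtain ⟨P, hP⟩ : ∃ P : ℕ → ℂ, ∀ n, P n = ∏ j ∈ Finset.Ico 1 n, a j := ⟨_, fun n => rfl⟩
  have hPn : ∀ n, ‖P n‖ = ∏ j ∈ Finset.Ico 1 n, ‖a j‖ := by
    intro n
    rw [hP, norm_prod]
  have hPs : ∀ n, 1 ≤ n → P (n + 1) = P n * a n := by
    intro n hn
    rw [hP, hP, Finset.prod_Ico_succ_top hn]
  have hP1 : P 1 = 1 := by simp [hP]
  have hδ : 0 < ε / M := div_pos hε hMpos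
  refine ⟨fun n => y n + ((ε / M : ℝ) : ℂ) * n * P n, ?_, ?_⟩
  · intro n hn
    have h : y (n + 1) + ((ε / M : ℝ) : ℂ) * ((n + 1 : ℕ) : ℂ) * P (n + 1)
        - (a n * (y n + ((ε / M : ℝ) : ℂ) * n * P n) + b n)
        = ((ε / M : ℝ) : ℂ) * P (n + 1) := by
      rw [hy, hPs n hn]
      push_cast
      ring
    simp only [h]
    rw [norm_mul, Complex.norm_real, Real.norm_of_nonneg hδ.le, hPn]
    calc ε / M * _ ≤ ε / M * M :=
          mul_le_mul_of_nonneg_left (hM (n + 1) (by omega)) hδ.le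
      _ = ε := div_mul_cancel₀ _ hMpos.ne'
  · intro z hz C
    have hzy : ∀ n, 1 ≤ n → z n = y n + (z 1 - y 1) * P n := by
      intro n hn
      induction n, hn using Nat.le_induction with
      | base => rw [hP1]; ring
      | succ n hn ih =>
        rw [hz n hn, hy, hPs n hn]
        linear_combination a n * ih
    obtain ⟨N, hN⟩ := exists_nat_gt ((|C| / c + ‖z 1 - y 1‖) / (ε / M))
    rw [div_lt_iff₀ hδ] at hN
    have hN' : 1 ≤ N := by
      rcases Nat.eq_zero_or_pos N with h | h
      · subst h
        have : 0 ≤ |C| / c + ‖z 1 - y 1‖ := by positivity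
        simp at hN
        linarith
      · exact h
    refine ⟨N, hN', ?_⟩
    have h : y N + ((ε / M : ℝ) : ℂ) * N * P N - z N
        = (((N * (ε / M) : ℝ) : ℂ) - (z 1 - y 1)) * P N := by
      rw [hzy N hN']
      push_cast
      ring
    simp only [h]
    rw [norm_mul, hPn]
    have h1 : |C| / c < ‖((N * (ε / M) : ℝ) : ℂ) - (z 1 - y 1)‖ := by
      have h2 := norm_sub_norm_le ((N * (ε / M) : ℝ) : ℂ) (z 1 - y 1)
      rw [Complex.norm_real, Real.norm_of_nonneg (by positivity)] at h2
      linarith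
    rw [div_lt_iff₀ hc] at h1
    calc C ≤ |C| := le_abs_self C
      _ < _ := h1
      _ ≤ _ := mul_le_mul_of_nonneg_left (hcP N hN') (norm_nonneg _)
end

section
/- Let $a_n, b_n$ be complex numbers with $a_n \neq 0$ for all $n \in \mathbb{N}$. Suppose there is a constant $M$ such that $1 + |a_n| + |a_n a_{n-1}| + \cdots + |a_n a_{n-1} \cdots a_2| \leq M$ for all $n \in \mathbb{N}$. Then the difference equation $z_{n+1} = a_n z_n + b_n$ has Hyers-Ulam stability: for every $\varepsilon > 0$ and every sequence $\{w_n\}$ with $|w_{n+1} - a_n w_n - b_n| \leq \varepsilon$ for all $n$, there exists a sequence $\{z_n\}$ satisfying $z_{n+1} = a_n z_n + b_n$ and $|w_n - z_n| \leq M\varepsilon$ for all $n \in \mathbb{N}$. -/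
/-- If the sums `1 + |a_n| + |a_n a_{n-1}| + ⋯ + |a_n ⋯ a_2|
= ∑_{k=2}^{n+1} ∏_{i=k}^{n} |a_i|` are bounded by `M`, then the difference
equation `z_{n+1} = a_n z_n + b_n` has Hyers-Ulam stability with bound `M ε`. -/
theorem stmt_8 (a b : ℕ → ℂ) (ha : ∀ n, 1 ≤ n → a n ≠ 0) (M : ℝ)
    (hM : ∀ n, 1 ≤ n →
      (∑ k ∈ Finset.Icc 2 (n + 1), ∏ i ∈ Finset.Icc k n, ‖a i‖) ≤ M) :
    ∀ ε : ℝ, 0 < ε → ∀ w : ℕ → ℂ,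
      (∀ n, 1 ≤ n → ‖w (n + 1) - (a n * w n + b n)‖ ≤ ε) →
      ∃ z : ℕ → ℂ, (∀ n, 1 ≤ n → z (n + 1) = a n * z n + b n) ∧
        ∀ n, 1 ≤ n → ‖w n - z n‖ ≤ M * ε := by
  intro ε hε w hw
  let y : ℕ → ℂ := fun k => Nat.rec (w 1) (fun k x => a (k + 1) * x + b (k + 1)) k
  have hy : ∀ k, y (k + 1) = a (k + 1) * y k + b (k + 1) := fun k => rfl
  have hS : ∀ m, (∑ k ∈ Finset.Icc 2 (m + 1 + 1), ∏ i ∈ Finset.Icc k (m + 1), ‖a i‖)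
      = ‖a (m + 1)‖ * (∑ k ∈ Finset.Icc 2 (m + 1), ∏ i ∈ Finset.Icc k m, ‖a i‖) + 1 := by
    intro m
    rw [Finset.sum_Icc_succ_top (by omega), Finset.mul_sum]
    congr 1
    · apply Finset.sum_congr rfl
      intro k hk
      rw [Finset.mem_Icc] at hk
      rw [Finset.prod_Icc_succ_top hk.2, mul_comm]
    · simp
  have key : ∀ m, ‖w (m + 1) - y m‖
      ≤ (∑ k ∈ Finset.Icc 2 (m + 1), ∏ i ∈ Finset.Icc k m, ‖a i‖) * ε := by
    intro m
    induction m with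
    | zero => simp [y]
    | succ m ih =>
      rw [hS, hy]
      have h1 : w (m + 1 + 1) - (a (m + 1) * y m + b (m + 1))
          = a (m + 1) * (w (m + 1) - y m)
            + (w (m + 1 + 1) - (a (m + 1) * w (m + 1) + b (m + 1))) := by ring
      rw [h1]
      refine (norm_add_le _ _).trans ?_
      rw [norm_mul]
      have h2 := hw (m + 1) (by omega)
      have h3 := mul_le_mul_of_nonneg_left ih (norm_nonneg (a (m + 1)))
      linarith
  refine ⟨fun n => y (n - 1), ?_, ?_⟩
  · intro n hn
    obtain ⟨m, rfl⟩ := Nat.exists_eq_add_of_le' hn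
    exact hy m
  · intro n hn
    obtain ⟨m, rfl⟩ := Nat.exists_eq_add_of_le' hn
    refine (key m).trans (mul_le_mul_of_nonneg_right ?_ hε.le)
    rcases Nat.eq_zero_or_pos m with rfl | hm
    · have := hM 1 le_rfl
      simp at this ⊢
      linarith
    · exact hM m hm
end

section
/- Let $a_n, b_n$ be complex numbers with $a_n \neq 0$ for all $n \in \mathbb{N}$, and suppose the coefficients $a_n$ are periodic with period $p \in \mathbb{N}$, i.e. $a_{n+p} = a_n$ for all $n \in \mathbb{N}$. If $\prod_{k=1}^{p} |a_k| < 1$, then the difference equation $z_{n+1} = a_n z_n + b_n$ has Hyers-Ulam stability: there exists a constant $C > 0$ such that for every $\varepsilon > 0$ and every sequence $\{w_n\}$ with $|w_{n+1} - a_n w_n - b_n| \leq \varepsilon$ for all $n$, there exists a sequence $\{z_n\}$ satisfying $z_{n+1} = a_n z_n + b_n$ and $|w_n - z_n| \leq C\varepsilon$ for all $n \in \mathbb{N}$. -/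
/-- Solution of `u (n+1) = α n * u n + 1` with `u 0 = x`. -/
def affSol (α : ℕ → ℝ) (x : ℝ) : ℕ → ℝ
  | 0 => x
  | n + 1 => α n * affSol α x n + 1

lemma affSol_eq (α : ℕ → ℝ) (x : ℝ) (n : ℕ) :
    affSol α x n = (∏ k ∈ Finset.range n, α k) * x + affSol α 0 n := by
  induction n with
  | zero => simp [affSol]
  | succ n ih => rw [affSol, ih, affSol, Finset.prod_range_succ]; ring

lemma affSol_nonneg (α : ℕ → ℝ) (hα : ∀ n, 0 ≤ α n) (x : ℝ) (hx : 0 ≤ x) (n : ℕ) :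
    0 ≤ affSol α x n := by
  induction n with
  | zero => exact hx
  | succ n ih => rw [affSol]; have := mul_nonneg (hα n) ih; linarith

lemma affSol_bdd (α : ℕ → ℝ) (hα : ∀ n, 0 ≤ α n) (p : ℕ) (hp : 1 ≤ p)
    (hper : ∀ n, α (n + p) = α n) (hprod : (∏ k ∈ Finset.range p, α k) < 1) :
    ∃ x : ℝ, 0 ≤ x ∧ ∃ C : ℝ, 0 < C ∧ ∀ n, affSol α x n ≤ C := by
  have h1 : 0 < 1 - ∏ k ∈ Finset.range p, α k := by linarith
  obtain ⟨x, hx⟩ : ∃ x, x = affSol α 0 p / (1 - ∏ k ∈ Finset.range p, α k) := ⟨_, rfl⟩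
  have hx0 : 0 ≤ x := hx ▸ div_nonneg (affSol_nonneg α hα 0 le_rfl p) h1.le
  have hnn := affSol_nonneg α hα x hx0
  have hP : affSol α x p = x := by
    rw [eq_div_iff h1.ne'] at hx
    rw [affSol_eq]; linarith
  have hu : Function.Periodic (affSol α x) p := by
    intro n
    induction n with
    | zero => rw [Nat.zero_add, hP]; rfl
    | succ n ih =>
      rw [show n + 1 + p = (n + p) + 1 by omega, affSol, ih, hper, affSol]
  refine ⟨x, hx0, (∑ k ∈ Finset.range p, affSol α x k) + 1, ?_, fun n => ?_⟩
  · have := Finset.sum_nonneg (fun k (_ : k ∈ Finset.range p) => hnn k)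
    linarith
  · rw [← hu.map_mod_nat n]
    have := Finset.single_le_sum (f := affSol α x) (fun k _ => hnn k)
      (Finset.mem_range.2 (Nat.mod_lt n hp))
    linarith

/-- Exact solution through `w 1`, index shifted by one. -/
noncomputable def exactSol (a b : ℕ → ℂ) (x : ℂ) : ℕ → ℂ
  | 0 => x
  | n + 1 => a (n + 1) * exactSol a b x n + b (n + 1)


/-- If the coefficients `a_n` are `p`-periodic and `∏_{k=1}^p |a_k| < 1`, then
the difference equation `z_{n+1} = a_n z_n + b_n` has Hyers-Ulam stability. -/
theorem stmt_9 (a b : ℕ → ℂ) (ha : ∀ n, 1 ≤ n → a n ≠ 0)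
    (p : ℕ) (hp : 1 ≤ p) (hper : ∀ n, 1 ≤ n → a (n + p) = a n)
    (hprod : (∏ k ∈ Finset.Icc 1 p, ‖a k‖) < 1) :
    ∃ C : ℝ, 0 < C ∧ ∀ ε : ℝ, 0 < ε → ∀ w : ℕ → ℂ,
      (∀ n, 1 ≤ n → ‖w (n + 1) - (a n * w n + b n)‖ ≤ ε) →
      ∃ z : ℕ → ℂ, (∀ n, 1 ≤ n → z (n + 1) = a n * z n + b n) ∧
        ∀ n, 1 ≤ n → ‖w n - z n‖ ≤ C * ε := by
  obtain ⟨x, hx0, C, hC, hb⟩ := affSol_bdd (fun n => ‖a (n + 1)‖) (fun n => norm_nonneg _) p hp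
    (fun n => by
      show ‖a (n + p + 1)‖ = ‖a (n + 1)‖
      rw [show n + p + 1 = (n + 1) + p by omega, hper _ (by omega)])
    (by
      have h := Finset.prod_Ico_eq_prod_range (fun k => ‖a k‖) 1 (p + 1)
      rw [Finset.Ico_add_one_right_eq_Icc] at h
      rw [h] at hprod
      simpa [add_comm] using hprod)
  refine ⟨C, hC, fun ε hε w hw => ⟨fun n => exactSol a b (w 1) (n - 1), ?_, ?_⟩⟩
  · intro n hn
    obtain ⟨m, rfl⟩ := Nat.exists_eq_add_of_le' hn
    simp [exactSol]
  · intro n hn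
    obtain ⟨m, rfl⟩ := Nat.exists_eq_add_of_le' hn
    have key : ‖w (m + 1) - exactSol a b (w 1) m‖ ≤
        affSol (fun n => ‖a (n + 1)‖) x m * ε := by
      clear hn
      induction m with
      | zero => simpa [exactSol, affSol] using mul_nonneg hx0 hε.le
      | succ m ih =>
        rw [exactSol, affSol]
        have e : w (m + 1 + 1) - (a (m + 1) * exactSol a b (w 1) m + b (m + 1)) =
          a (m + 1) * (w (m + 1) - exactSol a b (w 1) m) +
          (w (m + 1 + 1) - (a (m + 1) * w (m + 1) + b (m + 1))) := by ring
        rw [e]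
        refine (norm_add_le _ _).trans ?_
        rw [norm_mul]
        have h1 := hw (m + 1) (by omega)
        have h2 := mul_le_mul_of_nonneg_left ih (norm_nonneg (a (m + 1)))
        linarith
    exact key.trans (mul_le_mul_of_nonneg_right (hb m) hε.le)
end

section
/- Let $a_n, b_n$ be complex numbers with $a_n \neq 0$ for all $n \in \mathbb{N}$. Assume that $\lim_{n \to \infty} \left( \prod_{j=1}^{n-1} |a_j| \right)^{1/n} = 1$. Then the difference equation $z_{n+1} = a_n z_n + b_n$ does not have Hyers-Ulam stability: for every $\varepsilon > 0$ there exists a sequence $\{w_n\}$ with $|w_{n+1} - a_n w_n - b_n| \leq \varepsilon$ for all $n$, such that for every sequence $\{z_n\}$ satisfying $z_{n+1} = a_n z_n + b_n$ for all $n$, the quantity $\sup_{n \in \mathbb{N}} |w_n - z_n|$ is infinite. -/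
open Filter

lemma aux_growth (p : ℕ → ℝ) (hp : ∀ n, 0 < p n)
    (hlim : Tendsto (fun n : ℕ => (p n) ^ (1 / (n : ℝ))) atTop (nhds 1))
    (s : ℝ) (hs : 1 < s) (K : ℝ) (hK : 0 < K) :
    ∀ᶠ n : ℕ in atTop, K * p n < s ^ n ∧ K < p n * s ^ n := by
  obtain ⟨t, ht1, hts⟩ : ∃ t : ℝ, 1 < t ∧ t * t = s :=
    ⟨√s, by rw [Real.lt_sqrt] <;> linarith, Real.mul_self_sqrt (by linarith)⟩
  have ht0 : 0 < t := by linarith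
  have h1 := hlim.eventually (gt_mem_nhds ht1)
  have h2 := hlim.eventually (lt_mem_nhds (inv_lt_one_of_one_lt₀ ht1))
  have h3 := (tendsto_pow_atTop_atTop_of_one_lt ht1).eventually (eventually_gt_atTop K)
  filter_upwards [h1, h2, h3, eventually_ge_atTop 1] with n h1 h2 h3 hn
  have hpn := hp n
  have key : ((p n) ^ (1 / (n : ℝ))) ^ n = p n := by
    rw [one_div]
    exact Real.rpow_inv_natCast_pow hpn.le (by omega)
  have h0 : 0 ≤ (p n) ^ (1 / (n : ℝ)) := Real.rpow_nonneg hpn.le _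
  have k1 : p n ≤ t ^ n := by
    rw [← key]; exact pow_le_pow_left₀ h0 h1.le n
  have k2 : (t ^ n)⁻¹ ≤ p n := by
    rw [← key, ← inv_pow]; exact pow_le_pow_left₀ (by positivity) h2.le n
  have htn : 0 < t ^ n := by positivity
  rw [← hts, mul_pow]
  constructor
  · nlinarith
  · have : 1 ≤ p n * t ^ n := by
      rwa [inv_le_iff_one_le_mul₀ htn] at k2
    nlinarith

lemma aux_real (p x : ℕ → ℝ) (hp : ∀ n, 0 < p n)
    (hlim : Tendsto (fun n : ℕ => (p n) ^ (1 / (n : ℝ))) atTop (nhds 1))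
    (ε C : ℝ) (hε : 0 < ε) (hC : 0 < C)
    (hx : ∀ n, 1 ≤ n → x (n + 1) = x n + ε / p (n + 1))
    (hb : ∀ n, 1 ≤ n → p n * |x n| ≤ C) : False := by
  have hδ : 0 < ε / C := by positivity
  set δ := ε / C with hδd
  have hstep : ∀ n, 1 ≤ n → δ * |x (n + 1)| ≤ ε / p (n + 1) := by
    intro n hn
    have h := hb (n + 1) (by omega)
    rw [hδd, le_div_iff₀ (hp _), div_mul_eq_mul_div, div_mul_eq_mul_div, div_le_iff₀ hC]
    nlinarith
  have hpos : ∀ n, 0 < ε / p n := fun n => div_pos hε (hp n)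
  by_cases h : ∃ N, 1 ≤ N ∧ 0 < x N
  · obtain ⟨N, hN, hxN⟩ := h
    have hg : ∀ k, x N * (1 + δ) ^ k ≤ x (N + k) := by
      intro k
      induction k with
      | zero => simp
      | succ k ih =>
        have h1 := hx (N + k) (by omega)
        have h2 := hstep (N + k) (by omega)
        have h3 := hpos (N + k + 1)
        have h4 := le_abs_self (x (N + k + 1))
        have h5 : 0 < x N * (1 + δ) ^ k := by positivity
        rw [← add_assoc, pow_succ]
        have h6 : x (N + k) ≤ x (N + k + 1) := by linarith
        nlinarith
    obtain ⟨n, ⟨-, hn⟩, hnN⟩ := ((aux_growth p hp hlim (1 + δ) (by linarith)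
      (C * (1 + δ) ^ N / x N) (by positivity)).and (eventually_ge_atTop N)).exists
    obtain ⟨k, rfl⟩ := Nat.exists_eq_add_of_le hnN
    have h1 := hg k
    have h2 := hb (N + k) (by omega)
    rw [div_lt_iff₀ hxN, pow_add] at hn
    have h3 := le_abs_self (x (N + k))
    have h4 : p (N + k) * (x N * (1 + δ) ^ k) ≤ C :=
      le_trans (mul_le_mul_of_nonneg_left (h1.trans h3) (hp _).le) h2
    have h5 : 0 < (1 + δ) ^ N := by positivity
    nlinarith
  · push Not at h
    have hg : ∀ k, -x (1 + k) * (1 + δ) ^ k ≤ -x 1 := by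
      intro k
      induction k with
      | zero => simp
      | succ k ih =>
        have h1 := hx (1 + k) (by omega)
        have h2 := hstep (1 + k) (by omega)
        have h4 := neg_le_abs (x (1 + k + 1))
        have h5 : 0 < (1 + δ) ^ k := by positivity
        rw [← add_assoc, pow_succ]
        have h6 : -x (1 + k + 1) * (1 + δ) ≤ - x (1 + k) := by nlinarith
        nlinarith
    have hx1 : 0 < -x 1 := by
      have h1 := hx 1 le_rfl
      have h2 := h 2 (by omega)
      have h3 := hpos 2
      norm_num at h1
      linarith
    obtain ⟨n, ⟨hn, -⟩, hnN⟩ := ((aux_growth p hp hlim (1 + δ) (by linarith)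
      ((-x 1) * (1 + δ) ^ 2 / ε) (by positivity)).and (eventually_ge_atTop 2)).exists
    obtain ⟨k, rfl⟩ := Nat.exists_eq_add_of_le hnN
    have h1 := hg k
    have h2 := hx (1 + k) (by omega)
    have h3 := h (1 + k + 1) (by omega)
    rw [show 1 + k + 1 = 2 + k by omega] at h2 h3
    have hpp := hp (2 + k)
    have h4 : ε / p (2 + k) ≤ - x (1 + k) := by linarith
    rw [div_le_iff₀ hpp] at h4
    rw [div_mul_eq_mul_div, div_lt_iff₀ hε, pow_add] at hn
    have h5 : 0 < (1 + δ) ^ 2 := by positivity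
    have h6 : 0 < (1 + δ) ^ k := by positivity
    have h7 : ε * (1 + δ) ^ k ≤ -x 1 * p (2 + k) := by
      calc ε * (1 + δ) ^ k ≤ (-x (1 + k) * p (2 + k)) * (1 + δ) ^ k := by gcongr
        _ = (-x (1 + k) * (1 + δ) ^ k) * p (2 + k) := by ring
        _ ≤ _ := by gcongr
    nlinarith

/-- The perturbed orbit. -/
noncomputable def auxW (a b e : ℕ → ℂ) : ℕ → ℂ
  | 0 => 0
  | n + 1 => a n * auxW a b e n + b n + e n

/-- If `(∏_{j=1}^{n-1} |a_j|)^{1/n} → 1`, then the difference equation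
`z_{n+1} = a_n z_n + b_n` has no Hyers-Ulam stability. -/
theorem stmt_11 (a b : ℕ → ℂ) (ha : ∀ n, 1 ≤ n → a n ≠ 0)
    (hlim : Tendsto
      (fun n : ℕ => (∏ j ∈ Finset.Ico 1 n, ‖a j‖) ^ (1 / (n : ℝ)))
      atTop (nhds 1)) :
    ∀ ε : ℝ, 0 < ε → ∃ w : ℕ → ℂ,
      (∀ n, 1 ≤ n → ‖w (n + 1) - (a n * w n + b n)‖ ≤ ε) ∧
      ∀ z : ℕ → ℂ, (∀ n, 1 ≤ n → z (n + 1) = a n * z n + b n) →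
        ∀ C : ℝ, ∃ n, 1 ≤ n ∧ C < ‖w n - z n‖ := by
  intro ε hε
  obtain ⟨P, hP⟩ : ∃ P : ℕ → ℂ, P = fun n => ∏ j ∈ Finset.Ico 1 n, a j := ⟨_, rfl⟩
  have hP0 : ∀ n, P n ≠ 0 := by
    intro n
    rw [hP]
    exact Finset.prod_ne_zero_iff.2 fun j hj => ha j (Finset.mem_Ico.1 hj).1
  have hPs : ∀ n, 1 ≤ n → P (n + 1) = P n * a n := by
    intro n hn
    rw [hP]
    exact Finset.prod_Ico_succ_top hn _
  have hpn : ∀ n, 0 < ‖P n‖ := fun n => norm_pos_iff.2 (hP0 n)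
  have hlim' : Tendsto (fun n : ℕ => ‖P n‖ ^ (1 / (n : ℝ))) atTop (nhds 1) := by
    simpa only [hP, norm_prod] using hlim
  let e : ℕ → ℂ := fun n => ((ε / ‖P (n + 1)‖ : ℝ) : ℂ) * P (n + 1)
  have hw : ∀ n, auxW a b e (n + 1) = a n * auxW a b e n + b n + e n := fun n => rfl
  refine ⟨auxW a b e, ?_, ?_⟩
  · intro n hn
    rw [hw, add_sub_cancel_left, norm_mul, Complex.norm_real, Real.norm_eq_abs,
      abs_of_pos (div_pos hε (hpn _)), div_mul_cancel₀ _ (hpn _).ne']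
  · intro z hz C
    by_contra! hcon
    refine aux_real (fun n => ‖P n‖) (fun n => ((auxW a b e n - z n) / P n).re) hpn hlim'
      ε (max C 1) hε (by positivity) ?_ ?_
    · intro n hn
      have h : (auxW a b e (n + 1) - z (n + 1)) / P (n + 1)
          = (auxW a b e n - z n) / P n + ((ε / ‖P (n + 1)‖ : ℝ) : ℂ) := by
        have h1 := hP0 (n + 1)
        have h2 := hP0 n
        have h3 := ha n hn
        rw [hw, hz n hn, div_eq_iff h1, add_mul]
        have : (auxW a b e n - z n) / P n * P (n + 1) = a n * (auxW a b e n - z n) := by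
          rw [hPs n hn]; field_simp
        rw [this]
        simp only [e]
        ring
      simp only [h, Complex.add_re, Complex.ofReal_re]
    · intro n hn
      calc ‖P n‖ * |((auxW a b e n - z n) / P n).re|
          ≤ ‖P n‖ * ‖(auxW a b e n - z n) / P n‖ := by
            gcongr; exact Complex.abs_re_le_norm _
        _ = ‖auxW a b e n - z n‖ := by
            rw [norm_div, mul_div_cancel₀ _ (hpn n).ne']
        _ ≤ max C 1 := (hcon n hn).trans (le_max_left _ _)
end

section
/- Let $a_n, b_n$ be complex numbers with $a_n \neq 0$ for all $n \in \mathbb{N}$, and suppose the coefficients $a_n$ are periodic with period $p \in \mathbb{N}$, i.e. $a_{n+p} = a_n$ for all $n \in \mathbb{N}$. If $\prod_{k=1}^{p} |a_k| > 1$, then the difference equation $z_{n+1} = a_n z_n + b_n$ has Hyers-Ulam stability: there exists a constant $C > 0$ such that for every $\varepsilon > 0$ and every sequence $\{w_n\}$ with $|w_{n+1} - a_n w_n - b_n| \leq \varepsilon$ for all $n$, there exists a sequence $\{z_n\}$ satisfying $z_{n+1} = a_n z_n + b_n$ and $|w_n - z_n| \leq C\varepsilon$ for all $n \in \mathbb{N}$.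 -/
lemma aux_bound (Q : ℕ → ℝ) (hQ : ∀ n, 0 < Q n) (p : ℕ) (hp : 1 ≤ p) (M : ℝ) (hM : 1 < M)
    (hper : ∀ n, Q (n + p) = M * Q n) :
    ∃ s D : ℝ, 0 < s ∧ s < 1 ∧ 0 < D ∧ ∀ n j, Q n ≤ D * s ^ j * Q (n + j + 1) := by
  have hM0 : 0 < M := by linarith
  set s : ℝ := (M⁻¹) ^ ((p : ℝ)⁻¹) with hs
  have hs0 : 0 < s := Real.rpow_pos_of_pos (inv_pos.2 hM0) _
  have hs1 : s < 1 := Real.rpow_lt_one (inv_pos.2 hM0).le (inv_lt_one_of_one_lt₀ hM)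
    (inv_pos.2 (by exact_mod_cast hp))
  have hsp : s ^ p = M⁻¹ := Real.rpow_inv_natCast_pow (inv_pos.2 hM0).le (by omega)
  set h : ℕ → ℝ := fun n => Q n * s ^ n with hh
  have hpos : ∀ n, 0 < h n := fun n => mul_pos (hQ n) (pow_pos hs0 n)
  have hhp : Function.Periodic h p := by
    intro n
    simp only [hh, hper, pow_add, hsp]
    field_simp
  have hmod : ∀ n, n % p ∈ Finset.range p := fun n => Finset.mem_range.2 (Nat.mod_lt _ hp)
  set K := ∑ i ∈ Finset.range p, h i with hK
  set L := ∑ i ∈ Finset.range p, (h i)⁻¹ with hL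
  have h1 : ∀ n, h n ≤ K := fun n => by
    rw [← hhp.map_mod_nat n]
    exact Finset.single_le_sum (f := h) (fun i _ => (hpos i).le) (hmod n)
  have h2 : ∀ n, (h n)⁻¹ ≤ L := fun n => by
    rw [← hhp.map_mod_nat n]
    exact Finset.single_le_sum (f := fun i => (h i)⁻¹)
      (fun i _ => (inv_pos.2 (hpos i)).le) (hmod n)
  have hK0 : 0 < K := (hpos 0).trans_le (h1 0)
  have hL0 : 0 < L := (inv_pos.2 (hpos 0)).trans_le (h2 0)
  refine ⟨s, K * L, hs0, hs1, mul_pos hK0 hL0, fun n j => ?_⟩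
  have h3 : 1 ≤ L * h (n + j + 1) := by
    have := mul_le_mul_of_nonneg_right (h2 (n + j + 1)) (hpos (n + j + 1)).le
    rwa [inv_mul_cancel₀ (hpos _).ne'] at this
  have h4 : Q n * s ^ n ≤ (K * L * s ^ (j + 1) * Q (n + j + 1)) * s ^ n := by
    calc Q n * s ^ n ≤ K * 1 := by rw [mul_one]; exact h1 n
      _ ≤ K * (L * h (n + j + 1)) := mul_le_mul_of_nonneg_left h3 hK0.le
      _ = _ := by simp only [hh]; ring
  refine (le_of_mul_le_mul_right h4 (pow_pos hs0 n)).trans ?_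
  have h5 : s ^ (j + 1) ≤ s ^ j := pow_le_pow_of_le_one hs0.le hs1.le (by omega)
  have := hQ (n + j + 1)
  gcongr

/-- If the coefficients `a_n` are `p`-periodic and `∏_{k=1}^p |a_k| > 1`, then
the difference equation `z_{n+1} = a_n z_n + b_n` has Hyers-Ulam stability. -/
theorem stmt_18 (a b : ℕ → ℂ) (ha : ∀ n, 1 ≤ n → a n ≠ 0)
    (p : ℕ) (hp : 1 ≤ p) (hper : ∀ n, 1 ≤ n → a (n + p) = a n)
    (hprod : 1 < ∏ k ∈ Finset.Icc 1 p, ‖a k‖) :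
    ∃ C : ℝ, 0 < C ∧ ∀ ε : ℝ, 0 < ε → ∀ w : ℕ → ℂ,
      (∀ n, 1 ≤ n → ‖w (n + 1) - (a n * w n + b n)‖ ≤ ε) →
      ∃ z : ℕ → ℂ, (∀ n, 1 ≤ n → z (n + 1) = a n * z n + b n) ∧
        ∀ n, 1 ≤ n → ‖w n - z n‖ ≤ C * ε := by
  set P : ℕ → ℂ := fun n => ∏ k ∈ Finset.range n, a (k + 1) with hP
  have hP0 : ∀ n, P n ≠ 0 := fun n =>
    Finset.prod_ne_zero_iff.2 fun k _ => ha (k + 1) (by omega)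
  have hPs : ∀ n, P (n + 1) = a (n + 1) * P n := fun n => by
    simp only [hP, Finset.prod_range_succ]; ring
  have hM : ∏ k ∈ Finset.Icc 1 p, ‖a k‖ = ‖P p‖ := by
    simp only [hP, norm_prod]
    rw [← Finset.Ico_add_one_right_eq_Icc, Finset.prod_Ico_eq_prod_range]
    simp [add_comm]
  rw [hM] at hprod
  have hPp : ∀ n, P (n + p) = P p * P n := by
    intro n
    induction n with
    | zero => simp [hP]
    | succ n ih =>
      have := hper (n + 1) (by omega)
      rw [show n + 1 + p = n + p + 1 by ring, hPs, hPs, ih,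
        show n + p + 1 = n + 1 + p by ring, this]
      ring
  obtain ⟨s, D, hs0, hs1, hD, hb⟩ := aux_bound (fun n => ‖P n‖) (fun n => norm_pos_iff.2 (hP0 n))
    p hp ‖P p‖ hprod (fun n => by simp only [hPp, norm_mul])
  have hgeo := hasSum_geometric_of_lt_one hs0.le hs1
  refine ⟨D * (1 - s)⁻¹, mul_pos hD (inv_pos.2 (by linarith)), fun ε hε w hw => ?_⟩
  set f : ℕ → ℂ := fun n => (w (n + 2) - (a (n + 1) * w (n + 1) + b (n + 1))) / P (n + 1) with hf
  have hfb : ∀ n j, ‖P n * f (j + n)‖ ≤ D * ε * s ^ j := by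
    intro n j
    have h1 := hw (j + n + 1) (by omega)
    have h2 := hb n j
    have h3 : 0 < ‖P (j + n + 1)‖ := norm_pos_iff.2 (hP0 _)
    simp only [hf, norm_mul, norm_div]
    rw [show n + j + 1 = j + n + 1 by ring] at h2
    rw [← mul_div_assoc, div_le_iff₀ h3]
    calc _ ≤ (D * s ^ j * ‖P (j + n + 1)‖) * ε :=
          mul_le_mul h2 h1 (norm_nonneg _) (by positivity)
      _ = _ := by ring
  have hgeo2 := hgeo.mul_left (D * ε)
  have hsum : Summable f := by
    refine Summable.of_norm_bounded hgeo2.summable (fun j => ?_)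
    simpa [hP] using hfb 0 j
  have hsumn : ∀ n, Summable fun j => f (j + n) := fun n => (summable_nat_add_iff n).2 hsum
  set T : ℕ → ℂ := fun n => ∑' j, f (j + n) with hT
  have hTs : ∀ n, T n = f n + T (n + 1) := by
    intro n
    simp only [hT]
    rw [(hsumn n).tsum_eq_zero_add]
    simp [add_assoc, add_comm 1 n]
  refine ⟨fun n => w n + P (n - 1) * T (n - 1), fun n hn => ?_, fun n hn => ?_⟩
  · obtain ⟨m, rfl⟩ : ∃ m, n = m + 1 := ⟨n - 1, by omega⟩
    simp only [Nat.add_sub_cancel]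
    rw [hTs m]
    have : P (m + 1) * f m = w (m + 2) - (a (m + 1) * w (m + 1) + b (m + 1)) := by
      simp only [hf]; field_simp [hP0 (m + 1)]
    rw [hPs] at this ⊢
    rw [show m + 1 + 1 = m + 2 from rfl]
    linear_combination -this
  · have : w n - (w n + P (n - 1) * T (n - 1)) = -∑' j, P (n - 1) * f (j + (n - 1)) := by
      rw [tsum_mul_left]; simp [hT]
    simp only [this, norm_neg]
    refine (tsum_of_norm_bounded hgeo2 (hfb (n - 1))).trans (le_of_eq (by ring))
end
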